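/- For every n ≥ 1, the conductances c̃^n of the bottom row Ẽ_n = {x₀,…,x_{2^n}} (computed at level n) and the conductances c^n of E_n⁺ = {q₀} ∪ Ẽ_n (computed at level n) are related by: c̃^n_{x₀,x_{2^n}} = c^n_{x₀,x_{2^n}} + a_n/2^{n+1}; c̃^n_{x₀,x_j} = c^n_{x₀,x_j} + a_n/2^n for 0 < j < 2^n; and c̃^n_{x_i,x_j} = c^n_{x_i,x_j} + a_n/2^{n−1} for 0 < i < j < 2^n, where a_n = c^n_{q₀,x₀} = 7·5^n/(3^n + 6·10^n). -/

import Mathlib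

open scoped BigOperators

noncomputable section

namespace SGPaper

/-- The three corners of the Sierpinski gasket:
`q₀ = (1/2, √3/2)`, `q₁ = (0,0)`, `q₂ = (1,0)`. -/
def q : Fin 3 → ℝ × ℝ
  | 0 => (1 / 2, Real.sqrt 3 / 2)
  | 1 => (0, 0)
  | 2 => (1, 0)

/-- The contraction map towards corner `i`: `F_i(x) = (x + q_i)/2`. -/
def Fmap (i : Fin 3) (x : ℝ × ℝ) : ℝ × ℝ := (2⁻¹ : ℝ) • (x + q i)

/-- `Fword w = F_{w₁} ∘ ⋯ ∘ F_{w_m}` for the word `w = w₁⋯w_m`. -/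
def Fword (w : List (Fin 3)) : ℝ × ℝ → ℝ × ℝ :=
  w.foldr (fun i f => Fmap i ∘ f) id

/-- The level-`m` vertex set of the Sierpinski gasket:
`V_m = ⋃_{|w| = m} F_w({q₀, q₁, q₂})`. -/
def V (m : ℕ) : Set (ℝ × ℝ) :=
  {x | ∃ w : List (Fin 3), w.length = m ∧ ∃ i : Fin 3, x = Fword w (q i)}

/-- `x` and `y` are `m`-neighbors: they are distinct and belong to a common
level-`m` cell `F_w({q₀, q₁, q₂})`. -/
def Nbr (m : ℕ) (x y : ℝ × ℝ) : Prop :=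
  x ≠ y ∧ ∃ w : List (Fin 3), w.length = m ∧
    (∃ i : Fin 3, x = Fword w (q i)) ∧ (∃ j : Fin 3, y = Fword w (q j))

/-- The value `(u x - u y)²` on the unordered pair `{x, y}`. -/
def edgeVal (u : ℝ × ℝ → ℝ) : Sym2 (ℝ × ℝ) → ℝ :=
  Sym2.lift ⟨fun x y => (u x - u y) ^ 2, fun _ _ => by ring⟩

/-- The unordered pair `e` is an edge of the level-`m` graph `Γ_m`. -/
def IsEdge (m : ℕ) (e : Sym2 (ℝ × ℝ)) : Prop :=
  ∃ x y : ℝ × ℝ, Nbr m x y ∧ e = s(x, y)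

/-- The level-`m` graph energy: `E_m(u) = (5/3)^m Σ (u x − u y)²`, the sum being over
unordered `m`-neighbor pairs `{x, y}` (a finite set, so `tsum` is the honest sum). -/
def Energy (m : ℕ) (u : ℝ × ℝ → ℝ) : ℝ :=
  (5 / 3 : ℝ) ^ m * ∑' e : {e : Sym2 (ℝ × ℝ) // IsEdge m e}, edgeVal u e

/-- `Q_E(v)`: minimal level-`m` energy among functions `u : V_m → ℝ` agreeing
with `v` on `E` (the minimum is attained, so it equals this infimum). -/
def Q (m : ℕ) (E : Set (ℝ × ℝ)) (v : ℝ × ℝ → ℝ) : ℝ :=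
  sInf {r | ∃ u : ℝ × ℝ → ℝ, (∀ x ∈ E, u x = v x) ∧ r = Energy m u}

/-- Indicator function of the point `z`. -/
def ind (z : ℝ × ℝ) : ℝ × ℝ → ℝ := fun t => if t = z then 1 else 0

/-- The conductance `c^E_{x,y} = (Q_E(𝟙_x) + Q_E(𝟙_y) − Q_E(𝟙_x + 𝟙_y))/2`
between `x, y ∈ E`, computed at level `m`. -/
def cond (m : ℕ) (E : Set (ℝ × ℝ)) (x y : ℝ × ℝ) : ℝ :=
  (Q m E (ind x) + Q m E (ind y) - Q m E (ind x + ind y)) / 2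

/-- The `j`-th bottom-row point of `V_n`: `x_j = q₁ + (j/2ⁿ)(q₂ − q₁)`. -/
def xb (n j : ℕ) : ℝ × ℝ := q 1 + ((j : ℝ) / 2 ^ n) • (q 2 - q 1)

/-- The bottom row `Ẽ_n = {x₀, …, x_{2ⁿ}}` of `V_n`. -/
def Ebot (n : ℕ) : Set (ℝ × ℝ) := {p | ∃ j ≤ 2 ^ n, p = xb n j}

/-- The bottom row together with the top point: `E_n⁺ = {q₀, x₀, …, x_{2ⁿ}}`. -/
def Eplus (n : ℕ) : Set (ℝ × ℝ) := insert (q 0) (Ebot n)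

/-! ### Affine coordinates -/

def al (p : ℝ × ℝ) : ℝ := 2 * p.2 / Real.sqrt 3
def be (p : ℝ × ℝ) : ℝ := p.1 - p.2 / Real.sqrt 3

lemma s3 : Real.sqrt 3 ≠ 0 := by positivity

lemma coord_ext {p r : ℝ × ℝ} (h1 : al p = al r) (h2 : be p = be r) : p = r := by
  have := s3
  unfold al at h1
  unfold be at h2
  have h3 : p.2 = r.2 := by
    field_simp at h1
    linarith
  rw [h3] at h2
  exact Prod.ext (by linarith) h3

@[simp] lemma al0 : al (q 0) = 1 := by
  have := s3
  simp only [al, q]; field_simp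
@[simp] lemma al1 : al (q 1) = 0 := by simp [al, q]
@[simp] lemma al2 : al (q 2) = 0 := by simp [al, q]
@[simp] lemma be0 : be (q 0) = 0 := by
  have := s3
  simp only [be, q]; field_simp; norm_num
@[simp] lemma be1 : be (q 1) = 0 := by simp [be, q]
@[simp] lemma be2 : be (q 2) = 1 := by simp [be, q]

@[simp] lemma alF (i : Fin 3) (p : ℝ × ℝ) : al (Fmap i p) = (al p + al (q i)) / 2 := by
  simp only [al, Fmap, Prod.smul_snd, Prod.snd_add, smul_eq_mul]; ring
@[simp] lemma beF (i : Fin 3) (p : ℝ × ℝ) : be (Fmap i p) = (be p + be (q i)) / 2 := by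
  simp only [be, Fmap, Prod.smul_snd, Prod.snd_add, Prod.smul_fst, Prod.fst_add, smul_eq_mul]
  ring

@[simp] lemma al_xb (n j : ℕ) : al (xb n j) = 0 := by simp [al, xb, q]
@[simp] lemma be_xb (n j : ℕ) : be (xb n j) = j / 2 ^ n := by simp [be, xb, q]

lemma Fq_comm (i j : Fin 3) : Fmap i (q j) = Fmap j (q i) := by
  simp only [Fmap, add_comm]

lemma Fq_self (i : Fin 3) : Fmap i (q i) = q i := by
  apply coord_ext <;> simp

/-- The closed triangle. -/
def T : Set (ℝ × ℝ) := {p | 0 ≤ al p ∧ 0 ≤ be p ∧ al p + be p ≤ 1}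

lemma q_mem (i : Fin 3) : q i ∈ T := by
  fin_cases i <;> simp [T]

lemma F_mem (i : Fin 3) {p : ℝ × ℝ} (hp : p ∈ T) : Fmap i p ∈ T := by
  obtain ⟨h1, h2, h3⟩ := hp
  obtain ⟨k1, k2, k3⟩ := q_mem i
  have ha := alF i p
  have hb := beF i p
  refine ⟨?_, ?_, ?_⟩ <;> linarith

lemma overlap {i j : Fin 3} {p r : ℝ × ℝ} (hp : p ∈ T) (hr : r ∈ T)
    (h : Fmap i p = Fmap j r) : (i = j ∧ p = r) ∨ (p = q j ∧ r = q i) := by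
  obtain ⟨h1, h2, h3⟩ := hp
  obtain ⟨k1, k2, k3⟩ := hr
  have ha := congrArg al h
  have hb := congrArg be h
  rw [alF, alF] at ha
  rw [beF, beF] at hb
  fin_cases i <;> fin_cases j <;> simp at ha hb ⊢ <;>
    first
    | exact Or.inl (coord_ext (by linarith) (by linarith))
    | exact ⟨coord_ext (by simp; linarith) (by simp; linarith),
        coord_ext (by simp; linarith) (by simp; linarith)⟩

lemma glue (g : Fin 3 → (ℝ × ℝ) → ℝ) (hg : ∀ i j, g i (q j) = g j (q i)) :
    ∃ u : ℝ × ℝ → ℝ, ∀ i, ∀ p ∈ T, u (Fmap i p) = g i p := by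
  classical
  refine ⟨fun z => if h : ∃ ip : Fin 3 × (ℝ × ℝ), ip.2 ∈ T ∧ z = Fmap ip.1 ip.2 then
    g h.choose.1 h.choose.2 else 0, ?_⟩
  intro i p hp
  have h : ∃ ip : Fin 3 × (ℝ × ℝ), ip.2 ∈ T ∧ Fmap i p = Fmap ip.1 ip.2 := ⟨(i, p), hp, rfl⟩
  simp only [dif_pos h]
  obtain ⟨h1, h2⟩ := h.choose_spec
  rcases overlap hp h1 h2 with ⟨h3, h4⟩ | ⟨h3, h4⟩
  · rw [← h3, ← h4]
  · rw [h4, hg]; exact congrArg _ h3.symm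

/-! ### The recursive bilinear form -/

def B : ℕ → (ℝ × ℝ → ℝ) → (ℝ × ℝ → ℝ) → ℝ
  | 0, u, v => (u (q 0) - u (q 1)) * (v (q 0) - v (q 1)) +
      (u (q 1) - u (q 2)) * (v (q 1) - v (q 2)) + (u (q 2) - u (q 0)) * (v (q 2) - v (q 0))
  | n + 1, u, v => ∑ i : Fin 3, B n (u ∘ Fmap i) (v ∘ Fmap i)

lemma B_congr (n : ℕ) : ∀ (u u' f : ℝ × ℝ → ℝ), (∀ p ∈ T, u p = u' p) → B n u f = B n u' f := by
  induction n with
  | zero =>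
    intro u u' f h
    simp only [B, h _ (q_mem 0), h _ (q_mem 1), h _ (q_mem 2)]
  | succ n ih =>
    intro u u' f h
    simp only [B]
    exact Finset.sum_congr rfl fun i _ => ih _ _ _ fun p hp => h _ (F_mem i hp)

lemma B_smul (n : ℕ) : ∀ (u f : ℝ × ℝ → ℝ) (t : ℝ), B n (fun p => t * u p) f = t * B n u f := by
  induction n with
  | zero => intro u f t; simp only [B]; ring
  | succ n ih =>
    intro u f t
    simp only [B, Finset.mul_sum]
    exact Finset.sum_congr rfl fun i _ => ih (u ∘ Fmap i) _ t

lemma B_expand (n : ℕ) : ∀ (u h : ℝ × ℝ → ℝ) (t : ℝ),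
    B n (fun p => u p + t * h p) (fun p => u p + t * h p) =
      B n u u + 2 * t * B n h u + t ^ 2 * B n h h := by
  induction n with
  | zero => intro u h t; simp only [B]; ring
  | succ n ih =>
    intro u h t
    simp only [B, Finset.mul_sum, ← Finset.sum_add_distrib]
    exact Finset.sum_congr rfl fun i _ => ih (u ∘ Fmap i) (h ∘ Fmap i) t

lemma B_nonneg (n : ℕ) : ∀ (u : ℝ × ℝ → ℝ), 0 ≤ B n u u := by
  induction n with
  | zero => intro u; simp only [B]; nlinarith [sq_nonneg (u (q 0) - u (q 1)),
      sq_nonneg (u (q 1) - u (q 2)), sq_nonneg (u (q 2) - u (q 0))]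
  | succ n ih =>
    intro u
    exact Finset.sum_nonneg fun i _ => ih _

/-! ### The energy equals the recursive form -/

lemma Fword_cons (i : Fin 3) (w : List (Fin 3)) (p : ℝ × ℝ) :
    Fword (i :: w) p = Fmap i (Fword w p) := rfl

lemma al_word (w : List (Fin 3)) (p : ℝ × ℝ) :
    al (Fword w p) = al p / 2 ^ w.length + al (Fword w (q 1)) := by
  induction w with
  | nil => simp [Fword]
  | cons i w ih => rw [Fword_cons, Fword_cons, alF, alF, ih, List.length_cons, pow_succ]; ring

lemma be_word (w : List (Fin 3)) (p : ℝ × ℝ) :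
    be (Fword w p) = be p / 2 ^ w.length + be (Fword w (q 1)) := by
  induction w with
  | nil => simp [Fword]
  | cons i w ih => rw [Fword_cons, Fword_cons, beF, beF, ih, List.length_cons, pow_succ]; ring

lemma word_bd (w : List (Fin 3)) : (0 ≤ al (Fword w (q 1)) ∧ al (Fword w (q 1)) < 1) ∧
    (0 ≤ be (Fword w (q 1)) ∧ be (Fword w (q 1)) < 1) := by
  induction w with
  | nil => simp [Fword]
  | cons i w ih =>
    obtain ⟨⟨h1, h2⟩, h3, h4⟩ := ih
    rw [Fword_cons, alF, beF]
    fin_cases i <;> simp <;> refine ⟨⟨?_, ?_⟩, ?_, ?_⟩ <;> linarith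

lemma word_inj : ∀ (w w' : List (Fin 3)), w.length = w'.length →
    Fword w (q 1) = Fword w' (q 1) → w = w' := by
  intro w
  induction w with
  | nil => intro w' h _; exact (List.length_eq_zero_iff.1 h.symm).symm
  | cons i w ih =>
    intro w' hl h
    cases w' with
    | nil => simp at hl
    | cons j w' =>
      obtain ⟨⟨h1, h2⟩, h3, h4⟩ := word_bd w
      obtain ⟨⟨k1, k2⟩, k3, k4⟩ := word_bd w'
      rw [Fword_cons, Fword_cons] at h
      have ha := congrArg al h
      have hb := congrArg be h
      rw [alF, alF] at ha
      rw [beF, beF] at hb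
      have hij : i = j := by
        fin_cases i <;> fin_cases j <;> simp at ha hb ⊢ <;> linarith
      subst hij
      rw [ih w' (by simpa using hl) (coord_ext (by linarith) (by linarith))]

lemma edge_inj {w w' : List (Fin 3)} (hl : w.length = w'.length) {k l : Fin 3}
    (h : s(Fword w (q k), Fword w (q (k + 1))) = s(Fword w' (q l), Fword w' (q (l + 1)))) :
    w = w' ∧ k = l := by
  have hp : (0 : ℝ) < 2 ^ w'.length := by positivity
  have key : ∀ {a b c d : Fin 3}, Fword w (q a) = Fword w' (q c) →
      Fword w (q b) = Fword w' (q d) →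
      al (q a) - al (q b) = al (q c) - al (q d) ∧ be (q a) - be (q b) = be (q c) - be (q d) := by
    intro a b c d h1 h2
    have a1 := congrArg al h1
    have a2 := congrArg al h2
    have b1 := congrArg be h1
    have b2 := congrArg be h2
    rw [al_word w, al_word w', hl] at a1 a2
    rw [be_word w, be_word w', hl] at b1 b2
    constructor
    · have : (al (q a) - al (q b)) / 2 ^ w'.length = (al (q c) - al (q d)) / 2 ^ w'.length := by
        rw [sub_div, sub_div]; linarith
      exact (div_left_inj' hp.ne').1 this
    · have : (be (q a) - be (q b)) / 2 ^ w'.length = (be (q c) - be (q d)) / 2 ^ w'.length := by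
        rw [sub_div, sub_div]; linarith
      exact (div_left_inj' hp.ne').1 this
  rcases Sym2.eq_iff.1 h with ⟨h1, h2⟩ | ⟨h1, h2⟩
  · have hkl : k = l := by
      obtain ⟨ha, hb⟩ := key h1 h2
      fin_cases k <;> fin_cases l <;> simp at ha hb ⊢ <;> linarith
    subst hkl
    refine ⟨word_inj _ _ hl ?_, rfl⟩
    have a1 := congrArg al h1
    have b1 := congrArg be h1
    rw [al_word w, al_word w', hl] at a1
    rw [be_word w, be_word w', hl] at b1
    exact coord_ext (by linarith) (by linarith)
  · exfalso
    obtain ⟨ha, hb⟩ := key h1 h2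
    fin_cases k <;> fin_cases l <;> simp at ha hb <;> linarith

lemma Fword_inj (w : List (Fin 3)) {p r : ℝ × ℝ} (h : Fword w p = Fword w r) : p = r := by
  have hp : (2 : ℝ) ^ w.length ≠ 0 := by positivity
  have a1 := congrArg al h
  have b1 := congrArg be h
  rw [al_word w p, al_word w r] at a1
  rw [be_word w p, be_word w r] at b1
  exact coord_ext ((div_left_inj' hp).1 (by linarith)) ((div_left_inj' hp).1 (by linarith))

lemma q_ne (k : Fin 3) : q k ≠ q (k + 1) := by
  intro h
  have ha := congrArg al h
  have hb := congrArg be h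
  fin_cases k <;> simp at ha hb

def edgeMap (n : ℕ) (x : (Fin n → Fin 3) × Fin 3) : {e : Sym2 (ℝ × ℝ) // IsEdge n e} :=
  ⟨s(Fword (List.ofFn x.1) (q x.2), Fword (List.ofFn x.1) (q (x.2 + 1))),
    _, _, ⟨fun h => q_ne _ (Fword_inj _ h), List.ofFn x.1, by simp, ⟨_, rfl⟩, ⟨_, rfl⟩⟩, rfl⟩

lemma edgeMap_bij (n : ℕ) : Function.Bijective (edgeMap n) := by
  constructor
  · rintro ⟨w, k⟩ ⟨w', l⟩ h
    obtain ⟨h1, h2⟩ := edge_inj (by simp) (congrArg Subtype.val h)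
    exact Prod.ext (List.ofFn_injective h1) h2
  · rintro ⟨e, x, y, ⟨hne, w, hw, ⟨i, rfl⟩, ⟨j, rfl⟩⟩, rfl⟩
    subst hw
    have hij : i ≠ j := fun h => hne (by rw [h])
    have hk : j = i + 1 ∨ i = j + 1 := by clear hne; revert i j; decide
    rcases hk with rfl | rfl
    · refine ⟨(w.get, i), Subtype.ext ?_⟩
      simp [edgeMap]
    · refine ⟨(w.get, j), Subtype.ext ?_⟩
      simp only [edgeMap, List.ofFn_get]
      exact Sym2.eq_swap

lemma sum_words (n : ℕ) : ∀ u : ℝ × ℝ → ℝ, ∑ w : Fin n → Fin 3, ∑ k : Fin 3,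
    (u (Fword (List.ofFn w) (q k)) - u (Fword (List.ofFn w) (q (k + 1)))) ^ 2 = B n u u := by
  induction n with
  | zero =>
    intro u
    simp [Fword, B, Fin.sum_univ_three]
    ring
  | succ n ih =>
    intro u
    rw [← (Fin.consEquiv (fun _ => Fin 3)).sum_comp, Fintype.sum_prod_type]
    simp only [B]
    refine Finset.sum_congr rfl fun i _ => ?_
    rw [← ih]
    refine Finset.sum_congr rfl fun w _ => Finset.sum_congr rfl fun k _ => ?_
    simp [Fin.consEquiv, Fword_cons]

lemma energy_eq (n : ℕ) (u : ℝ × ℝ → ℝ) : Energy n u = (5 / 3 : ℝ) ^ n * B n u u := by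
  unfold Energy
  rw [← (Equiv.ofBijective _ (edgeMap_bij n)).tsum_eq, tsum_fintype, Fintype.sum_prod_type,
    ← sum_words]
  rfl

/-! ### Harmonic functions -/

lemma exists_harm (n : ℕ) : ∀ a0 a1 a2 : ℝ, ∃ u : ℝ × ℝ → ℝ,
    u (q 0) = a0 ∧ u (q 1) = a1 ∧ u (q 2) = a2 ∧ ∀ f, (5 / 3 : ℝ) ^ n * B n u f =
      (a0 - a1) * (f (q 0) - f (q 1)) + (a1 - a2) * (f (q 1) - f (q 2)) +
      (a2 - a0) * (f (q 2) - f (q 0)) := by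
  induction n with
  | zero =>
    intro a0 a1 a2
    refine ⟨fun p => a0 * al p + a2 * be p + a1 * (1 - al p - be p), by simp, by simp, by simp, ?_⟩
    intro f
    simp [B]
  | succ n ih =>
    intro a0 a1 a2
    obtain ⟨u0, h00, h01, h02, h0⟩ := ih a0 ((2 * a0 + 2 * a1 + a2) / 5) ((2 * a0 + a1 + 2 * a2) / 5)
    obtain ⟨u1, h10, h11, h12, h1⟩ := ih ((2 * a0 + 2 * a1 + a2) / 5) a1 ((a0 + 2 * a1 + 2 * a2) / 5)
    obtain ⟨u2, h20, h21, h22, h2⟩ := ih ((2 * a0 + a1 + 2 * a2) / 5) ((a0 + 2 * a1 + 2 * a2) / 5) a2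
    obtain ⟨u, hu⟩ := glue ![u0, u1, u2] (by
      intro i j
      fin_cases i <;> fin_cases j <;> simp [*])
    refine ⟨u, ?_, ?_, ?_, ?_⟩
    · rw [← Fq_self 0, hu 0 _ (q_mem 0)]; exact h00
    · rw [← Fq_self 1, hu 1 _ (q_mem 1)]; exact h11
    · rw [← Fq_self 2, hu 2 _ (q_mem 2)]; exact h22
    · intro f
      have e0 : B n (u ∘ Fmap 0) (f ∘ Fmap 0) = B n u0 (f ∘ Fmap 0) := B_congr _ _ _ _ (hu 0)
      have e1 : B n (u ∘ Fmap 1) (f ∘ Fmap 1) = B n u1 (f ∘ Fmap 1) := B_congr _ _ _ _ (hu 1)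
      have e2 : B n (u ∘ Fmap 2) (f ∘ Fmap 2) = B n u2 (f ∘ Fmap 2) := B_congr _ _ _ _ (hu 2)
      rw [B, Fin.sum_univ_three, e0, e1, e2, pow_succ]
      have k0 := h0 (f ∘ Fmap 0)
      have k1 := h1 (f ∘ Fmap 1)
      have k2 := h2 (f ∘ Fmap 2)
      simp only [Function.comp, Fq_self, Fq_comm 1 0, Fq_comm 2 0, Fq_comm 2 1] at k0 k1 k2
      linear_combination (5 / 3 : ℝ) * (k0 + k1 + k2)

def an (n : ℕ) : ℝ := 7 * 5 ^ n / (3 ^ n + 6 * 10 ^ n)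

lemma an_pos (n : ℕ) : 0 < an n := by unfold an; positivity

lemma an_succ (n : ℕ) : an (n + 1) = 5 / 3 * (1 / (1 + 2 ^ (n + 1) * an n)) * an n := by
  have h1 : (10 : ℝ) ^ n = 2 ^ n * 5 ^ n := by rw [← mul_pow]; norm_num
  have h2 : (0 : ℝ) < 3 ^ n := by positivity
  have h3 : (0 : ℝ) < 2 ^ n := by positivity
  have h4 : (0 : ℝ) < 5 ^ n := by positivity
  unfold an
  simp only [pow_succ, h1]
  have h5 : (0 : ℝ) < 3 ^ n + 6 * (2 ^ n * 5 ^ n) := by positivity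
  have h6 : (0 : ℝ) < 3 ^ n * 3 + 6 * (2 ^ n * 5 ^ n * 10) := by positivity
  have h7 : (0 : ℝ) < 3 ^ n + 6 * (2 ^ n * 5 ^ n) + 2 ^ n * 2 * (7 * 5 ^ n) := by positivity
  have h8 : 1 + 2 ^ n * 2 * (7 * (5:ℝ) ^ n / (3 ^ n + 6 * (2 ^ n * 5 ^ n))) =
    (3 ^ n + 6 * (2 ^ n * 5 ^ n) + 2 ^ n * 2 * (7 * 5 ^ n)) / (3 ^ n + 6 * (2 ^ n * 5 ^ n)) := by
    field_simp
  rw [h8, one_div_div, div_eq_iff h6.ne']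
  field_simp
  ring

def Lf (n : ℕ) (f : ℝ × ℝ → ℝ) : ℝ :=
  an n * ∑ j ∈ Finset.range (2 ^ n), (f (xb n j) + f (xb n (j + 1)))

lemma F1_xb (n j : ℕ) : Fmap 1 (xb n j) = xb (n + 1) j := by
  apply coord_ext <;> simp
  rw [pow_succ]; field_simp

lemma F2_xb (n j : ℕ) : Fmap 2 (xb n j) = xb (n + 1) (2 ^ n + j) := by
  apply coord_ext <;> simp
  rw [pow_succ]; field_simp; ring

lemma xb_zero (n : ℕ) : xb n 0 = q 1 := by apply coord_ext <;> simp
lemma xb_last (n : ℕ) : xb n (2 ^ n) = q 2 := by apply coord_ext <;> simp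

lemma xb_mem {n j : ℕ} (hj : j ≤ 2 ^ n) : xb n j ∈ T := by
  have : (j : ℝ) / 2 ^ n ≤ 1 := by
    rw [div_le_one (by positivity)]; exact_mod_cast hj
  refine ⟨by simp, by simp; positivity, by simpa using this⟩

lemma exists_h (n : ℕ) : ∃ h : ℝ × ℝ → ℝ, h (q 0) = 1 ∧ (∀ j ≤ 2 ^ n, h (xb n j) = 0) ∧
    ∀ f, (5 / 3 : ℝ) ^ n * B n h f = 2 ^ (n + 1) * an n * f (q 0) - Lf n f := by
  induction n with
  | zero =>
    refine ⟨al, by simp, by simp, ?_⟩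
    intro f
    have e0 : xb 0 0 = q 1 := xb_zero 0
    have e1 : xb 0 1 = q 2 := by simpa using xb_last 0
    simp [B, Lf, an, e0, e1]
    ring
  | succ n ih =>
    obtain ⟨h, hq, hz, hf⟩ := ih
    set S : ℝ := 2 ^ (n + 1) * an n with hS
    have hSpos : 0 < S := by have := an_pos n; positivity
    set b : ℝ := 1 / (1 + S) with hb
    have hbS : b * S = 1 - b := by rw [hb]; field_simp; ring
    have hsucc : an (n + 1) = 5 / 3 * b * an n := an_succ n
    have hz1 : h (q 1) = 0 := by rw [← xb_zero n]; exact hz _ (by positivity)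
    have hz2 : h (q 2) = 0 := by rw [← xb_last n]; exact hz _ le_rfl
    obtain ⟨u0, h00, h01, h02, h0⟩ := exists_harm n 1 b b
    obtain ⟨u, hu⟩ := glue ![u0, fun p => b * h p, fun p => b * h p] (by
      intro i j
      fin_cases i <;> fin_cases j <;> simp [*])
    have hu1 : ∀ p ∈ T, u (Fmap 1 p) = b * h p := hu 1
    have hu2 : ∀ p ∈ T, u (Fmap 2 p) = b * h p := hu 2
    refine ⟨u, ?_, ?_, ?_⟩
    · rw [← Fq_self 0, hu 0 _ (q_mem 0)]; exact h00
    · intro j hj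
      rcases le_total j (2 ^ n) with hj' | hj'
      · rw [← F1_xb, hu1 _ (xb_mem hj'), hz _ hj', mul_zero]
      · obtain ⟨k, rfl⟩ := Nat.exists_eq_add_of_le hj'
        have hk : k ≤ 2 ^ n := by rw [pow_succ] at hj; omega
        rw [← F2_xb, hu2 _ (xb_mem hk), hz _ hk, mul_zero]
    · intro f
      have e0 : B n (u ∘ Fmap 0) (f ∘ Fmap 0) = B n u0 (f ∘ Fmap 0) := B_congr _ _ _ _ (hu 0)
      have e1 : B n (u ∘ Fmap 1) (f ∘ Fmap 1) = b * B n h (f ∘ Fmap 1) := by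
        rw [← B_smul]; exact B_congr _ _ _ _ hu1
      have e2 : B n (u ∘ Fmap 2) (f ∘ Fmap 2) = b * B n h (f ∘ Fmap 2) := by
        rw [← B_smul]; exact B_congr _ _ _ _ hu2
      have eL : Lf (n + 1) f = 5 / 3 * b * (Lf n (f ∘ Fmap 1) + Lf n (f ∘ Fmap 2)) := by
        unfold Lf
        rw [hsucc, pow_succ 2 n, mul_two, Finset.sum_range_add]
        simp only [Function.comp, F1_xb, F2_xb, add_assoc]
        ring
      rw [B, Fin.sum_univ_three, e0, e1, e2, eL, hsucc]
      have k0 := h0 (f ∘ Fmap 0)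
      have k1 := hf (f ∘ Fmap 1)
      have k2 := hf (f ∘ Fmap 2)
      simp only [Function.comp, Fq_self, Fq_comm 1 0, Fq_comm 2 0] at k0 k1 k2
      have hS' : (2 : ℝ) ^ (n + 1 + 1) * (5 / 3 * b * an n) = 10 / 3 * (b * S) := by
        rw [hS]; ring
      rw [hS', hbS, pow_succ]
      linear_combination (5 / 3 : ℝ) * (k0 + b * k1 + b * k2) +
        5 / 3 * (f (Fmap 0 (q 1)) + f (Fmap 0 (q 2))) * hbS

/-! ### Traces -/

lemma Lf_congr {n : ℕ} {u v : ℝ × ℝ → ℝ} (h : ∀ x ∈ Ebot n, u x = v x) : Lf n u = Lf n v := by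
  unfold Lf
  congr 1
  refine Finset.sum_congr rfl fun j hj => ?_
  have := Finset.mem_range.1 hj
  rw [h _ ⟨j, by omega, rfl⟩, h _ ⟨j + 1, by omega, rfl⟩]

lemma Lf_add (n : ℕ) (u v : ℝ × ℝ → ℝ) : Lf n (u + v) = Lf n u + Lf n v := by
  unfold Lf
  rw [← mul_add, ← Finset.sum_add_distrib]
  congr 1
  refine Finset.sum_congr rfl fun j _ => ?_
  simp only [Pi.add_apply]; ring

lemma q0_notin (n : ℕ) : q 0 ∉ Ebot n := by
  rintro ⟨j, _, h⟩
  have := congrArg al h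
  simp at this

lemma xb_inj {n i j : ℕ} (h : xb n i = xb n j) : i = j := by
  have := congrArg be h
  simp only [be_xb] at this
  have h2 := (div_left_inj' (by positivity : (2 : ℝ) ^ n ≠ 0)).1 this
  exact_mod_cast h2

lemma Lf_ind (n i : ℕ) : Lf n (ind (xb n i)) =
    an n * ((if i < 2 ^ n then 1 else 0) + (if 0 < i ∧ i ≤ 2 ^ n then 1 else 0)) := by
  unfold Lf
  congr 1
  rw [Finset.sum_add_distrib]
  have e : ∀ j, ind (xb n i) (xb n j) = if j = i then 1 else 0 := by
    intro j
    unfold ind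
    by_cases hji : j = i
    · simp [hji]
    · rw [if_neg hji, if_neg fun h => hji (xb_inj h)]
  simp only [e]
  congr 1
  · simp
  · rcases Nat.eq_zero_or_pos i with rfl | hi
    · simp
    · obtain ⟨k, rfl⟩ := Nat.exists_eq_add_of_le' hi
      simp

lemma energy_nonneg (n : ℕ) (u : ℝ × ℝ → ℝ) : 0 ≤ Energy n u := by
  rw [energy_eq]; have := B_nonneg n u; positivity

lemma Q_le {n : ℕ} {E : Set (ℝ × ℝ)} {v u : ℝ × ℝ → ℝ} (h : ∀ x ∈ E, u x = v x) :
    Q n E v ≤ Energy n u :=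
  csInf_le ⟨0, by rintro r ⟨u, _, rfl⟩; exact energy_nonneg n u⟩ ⟨u, h, rfl⟩

lemma le_Q {n : ℕ} {E : Set (ℝ × ℝ)} {v : ℝ × ℝ → ℝ} {c : ℝ}
    (h : ∀ u : ℝ × ℝ → ℝ, (∀ x ∈ E, u x = v x) → c ≤ Energy n u) : c ≤ Q n E v :=
  le_csInf ⟨_, v, fun _ _ => rfl, rfl⟩ (by rintro r ⟨u, hu, rfl⟩; exact h u hu)

def Sn (n : ℕ) : ℝ := 2 ^ (n + 1) * an n

lemma Sn_pos (n : ℕ) : 0 < Sn n := by have := an_pos n; unfold Sn; positivity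

lemma exists_h' (n : ℕ) : ∃ h : ℝ × ℝ → ℝ, h (q 0) = 1 ∧ (∀ x ∈ Ebot n, h x = 0) ∧
    ∀ u t, Energy n (fun p => u p + t * h p) =
      Energy n u + 2 * t * (Sn n * u (q 0) - Lf n u) + t ^ 2 * Sn n := by
  obtain ⟨h, h1, h2, h3⟩ := exists_h n
  have h2' : ∀ x ∈ Ebot n, h x = 0 := by rintro x ⟨j, hj, rfl⟩; exact h2 j hj
  refine ⟨h, h1, h2', fun u t => ?_⟩
  have hL : Lf n h = 0 := by
    rw [Lf_congr (v := fun _ => 0) h2']; simp [Lf]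
  have k1 := h3 u
  have k2 := h3 h
  rw [hL, h1] at k2
  rw [energy_eq, energy_eq, B_expand]
  unfold Sn
  linear_combination 2 * t * k1 + t ^ 2 * k2

lemma Q_top (n : ℕ) : Q n (Eplus n) (ind (q 0)) = Sn n := by
  obtain ⟨h, h1, h2, h3⟩ := exists_h' n
  have hx : ∀ x ∈ Ebot n, ind (q 0) x = 0 := fun x hx =>
    if_neg fun (e : x = q 0) => q0_notin n (e ▸ hx)
  have e0 : Energy n (fun _ => 0) = 0 := by
    have := B_smul n (fun _ => 0) (fun _ => 0) 0
    rw [energy_eq]; simp at this; rw [this, mul_zero]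
  apply le_antisymm
  · have := h3 (fun _ => 0) 1
    rw [e0] at this
    have hL : Lf n (fun _ => 0) = 0 := by simp [Lf]
    rw [hL] at this
    refine (Q_le ?_).trans (by rw [this]; simp : Energy n (fun p => 0 + 1 * h p) ≤ _)
    rintro x (rfl | hx')
    · simp [h1, ind]
    · rw [hx x hx', h2 x hx']; simp
  · refine le_Q fun u hu => ?_
    have k := h3 u (-1)
    have hL : Lf n u = 0 := by
      rw [Lf_congr (v := fun _ => 0)]
      · simp [Lf]
      · intro x hx'; rw [hu x (Or.inr hx'), hx x hx']
    have hu0 : u (q 0) = 1 := by rw [hu _ (Or.inl rfl)]; simp [ind]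
    rw [hL, hu0] at k
    have := energy_nonneg n (fun p => u p + (-1) * h p)
    linarith

lemma Q_shift (n : ℕ) (v : ℝ × ℝ → ℝ) (hv : v (q 0) = 0) :
    Q n (Eplus n) (ind (q 0) + v) = Q n (Eplus n) v - 2 * Lf n v + Sn n := by
  obtain ⟨h, h1, h2, h3⟩ := exists_h' n
  have hx : ∀ x ∈ Ebot n, ind (q 0) x = 0 := fun x hx =>
    if_neg fun (e : x = q 0) => q0_notin n (e ▸ hx)
  have hi : ind (q 0) (q 0) = 1 := by simp [ind]
  apply le_antisymm
  · have : Q n (Eplus n) (ind (q 0) + v) + 2 * Lf n v - Sn n ≤ Q n (Eplus n) v := by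
      refine le_Q fun u hu => ?_
      have k := h3 u 1
      rw [Lf_congr fun x hx' => hu x (Or.inr hx'), hu _ (Or.inl rfl), hv] at k
      have : Q n (Eplus n) (ind (q 0) + v) ≤ Energy n (fun p => u p + 1 * h p) := by
        apply Q_le
        rintro x (rfl | hx')
        · simp [h1, hi, hv, hu _ (Or.inl rfl)]
        · simp [hx x hx', h2 x hx', hu x (Or.inr hx')]
      linarith
    linarith
  · refine le_Q fun u hu => ?_
    have k := h3 u (-1)
    have hub : ∀ x ∈ Ebot n, u x = v x := fun x hx' => by
      rw [hu x (Or.inr hx'), Pi.add_apply, hx x hx', zero_add]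
    have hu0 : u (q 0) = 1 := by rw [hu _ (Or.inl rfl), Pi.add_apply, hi, hv, add_zero]
    rw [Lf_congr hub, hu0] at k
    have : Q n (Eplus n) v ≤ Energy n (fun p => u p + (-1) * h p) := by
      apply Q_le
      rintro x (rfl | hx')
      · simp [h1, hu0, hv]
      · simp [h2 x hx', hub x hx']
    linarith

lemma Q_bot (n : ℕ) (v : ℝ × ℝ → ℝ) (hv : v (q 0) = 0) :
    Q n (Ebot n) v = Q n (Eplus n) v - Lf n v ^ 2 / Sn n := by
  obtain ⟨h, h1, h2, h3⟩ := exists_h' n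
  have hS := Sn_pos n
  apply le_antisymm
  · have : Q n (Ebot n) v + Lf n v ^ 2 / Sn n ≤ Q n (Eplus n) v := by
      refine le_Q fun u hu => ?_
      have k := h3 u (Lf n v / Sn n)
      rw [Lf_congr fun x hx' => hu x (Or.inr hx'), hu _ (Or.inl rfl), hv] at k
      have : Q n (Ebot n) v ≤ Energy n (fun p => u p + (Lf n v / Sn n) * h p) := by
        apply Q_le
        intro x hx'
        simp [h2 x hx', hu x (Or.inr hx')]
      have e : 2 * (Lf n v / Sn n) * (Sn n * 0 - Lf n v) + (Lf n v / Sn n) ^ 2 * Sn n =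
          - (Lf n v ^ 2 / Sn n) := by field_simp; ring
      linarith
    linarith
  · refine le_Q fun u hu => ?_
    have k := h3 u (-u (q 0))
    rw [Lf_congr hu] at k
    have : Q n (Eplus n) v ≤ Energy n (fun p => u p + (-u (q 0)) * h p) := by
      apply Q_le
      rintro x (rfl | hx')
      · simp [h1, hv]
      · simp [h2 x hx', hu x hx']
    have e : 0 ≤ (Sn n * u (q 0) - Lf n v) ^ 2 / Sn n := by positivity
    have e2 : (Sn n * u (q 0) - Lf n v) ^ 2 / Sn n =
        Sn n * u (q 0) ^ 2 - 2 * u (q 0) * Lf n v + Lf n v ^ 2 / Sn n := by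
      field_simp; ring
    rw [e2] at e
    linarith

lemma ind_top (n j : ℕ) : ind (xb n j) (q 0) = 0 := by
  refine if_neg fun h => ?_
  have := congrArg al h
  simp at this

lemma cond_bot (n i j : ℕ) : cond n (Ebot n) (xb n i) (xb n j) =
    cond n (Eplus n) (xb n i) (xb n j) +
      Lf n (ind (xb n i)) * Lf n (ind (xb n j)) / Sn n := by
  unfold cond
  rw [Q_bot n _ (ind_top n i), Q_bot n _ (ind_top n j),
    Q_bot n (ind (xb n i) + ind (xb n j)) (by simp [ind_top]), Lf_add]
  ring

/-- Relation between the conductances `c̃ⁿ` of the bottom row `Ẽ_n` and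
the conductances `cⁿ` of `E_n⁺ = {q₀} ∪ Ẽ_n`, both computed at level `n`, where
`a_n = c^n_{q₀,x₀} = 7·5ⁿ/(3ⁿ + 6·10ⁿ)`. -/
theorem stmt15 (n : ℕ) (hn : 1 ≤ n) :
    cond n (Eplus n) (q 0) (xb n 0) = 7 * 5 ^ n / (3 ^ n + 6 * 10 ^ n) ∧
    cond n (Ebot n) (xb n 0) (xb n (2 ^ n)) =
      cond n (Eplus n) (xb n 0) (xb n (2 ^ n)) +
        (7 * 5 ^ n / (3 ^ n + 6 * 10 ^ n)) / 2 ^ (n + 1) ∧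
    (∀ j : ℕ, 0 < j → j < 2 ^ n →
      cond n (Ebot n) (xb n 0) (xb n j) =
        cond n (Eplus n) (xb n 0) (xb n j) +
          (7 * 5 ^ n / (3 ^ n + 6 * 10 ^ n)) / 2 ^ n) ∧
    (∀ i j : ℕ, 0 < i → i < j → j < 2 ^ n →
      cond n (Ebot n) (xb n i) (xb n j) =
        cond n (Eplus n) (xb n i) (xb n j) +
          (7 * 5 ^ n / (3 ^ n + 6 * 10 ^ n)) / 2 ^ (n - 1)) := by
  have ha : (7 * 5 ^ n / (3 ^ n + 6 * 10 ^ n) : ℝ) = an n := rfl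
  have hpos := an_pos n
  have h2 : 0 < 2 ^ n := by positivity
  rw [ha]
  have L0 : Lf n (ind (xb n 0)) = an n := by rw [Lf_ind]; simp
  have LN : Lf n (ind (xb n (2 ^ n))) = an n := by rw [Lf_ind]; simp
  have Lj : ∀ j, 0 < j → j < 2 ^ n → Lf n (ind (xb n j)) = 2 * an n := by
    intro j h1 h3
    rw [Lf_ind, if_pos h3, if_pos ⟨h1, h3.le⟩]; ring
  refine ⟨?_, ?_, ?_, ?_⟩
  · unfold cond
    rw [Q_shift n _ (ind_top n 0), Q_top, L0]; ring
  · rw [cond_bot, L0, LN, Sn]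
    congr 1
    field_simp
  · intro j h1 h3
    rw [cond_bot, L0, Lj j h1 h3, Sn, pow_succ]
    congr 1
    field_simp
  · intro i j h1 h3 h4
    rw [cond_bot, Lj i h1 (h3.trans h4), Lj j (h1.trans h3) h4, Sn]
    congr 1
    obtain ⟨m, rfl⟩ := Nat.exists_eq_add_of_le' hn
    simp only [Nat.add_sub_cancel, pow_succ]
    field_simp
    try norm_num

end SGPaper
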